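/- Let Λ be a lattice in ℝ^n, let Q be a positive definite symmetric bilinear form on ℝ^n that is integral with respect to Λ, fix r ∈ ℝ^n, and let b ∈ ℤ^n. Then for every x ∈ ℝ^n the supremum defining Θ_b(x) = sup_{λ∈Λ}[⟨b,x⟩ + Q(λ,x) − (1/2)Q(λ+v_b−r, λ+v_b−r)] is finite and attained, and Θ_b is a theta function for (Q, Q(·,r)): it is convex, regular, and satisfies Θ_b(x+μ) = Θ_b(x) + Q(μ,x) + (1/2)Q(μ,μ) + Q(μ,r) for all μ ∈ Λ and x ∈ ℝ^n. -/

import Mathlib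

noncomputable section

/-- Standard inner product on ℝ^n. -/
def dotp {n : ℕ} (a x : Fin n → ℝ) : ℝ := ∑ i, a i * x i

/-- Λ is a (full-rank) lattice in ℝ^n. -/
def IsLattice {n : ℕ} (Λ : Set (Fin n → ℝ)) : Prop :=
  ∃ e : Module.Basis (Fin n) ℝ (Fin n → ℝ),
    Λ = {x | ∃ c : Fin n → ℤ, x = ∑ i, (c i : ℝ) • e i}

/-- Q is a symmetric bilinear form. -/
def IsSymmBilin {n : ℕ} (Q : (Fin n → ℝ) → (Fin n → ℝ) → ℝ) : Prop :=
  (∀ x, IsLinearMap ℝ (Q x)) ∧ ∀ x y, Q x y = Q y x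

/-- Quasi-periodicity condition for (Q, α). -/
def QuasiPeriodic {n : ℕ} (Λ : Set (Fin n → ℝ))
    (Q : (Fin n → ℝ) → (Fin n → ℝ) → ℝ) (α : (Fin n → ℝ) → ℝ)
    (Θ : (Fin n → ℝ) → ℝ) : Prop :=
  ∀ l ∈ Λ, ∀ x, Θ (x + l) = Θ x + Q l x + (1/2) * Q l l + α l

/-- Θ is regular: locally a max of finitely many affine functions with integral slopes. -/
def RegularFn {n : ℕ} (Θ : (Fin n → ℝ) → ℝ) : Prop :=
  ∀ x : Fin n → ℝ, ∃ U ∈ nhds x, ∃ (k : ℕ) (a : Fin (k+1) → Fin n → ℤ) (c : Fin (k+1) → ℝ),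
    ∀ y ∈ U, Θ y = Finset.univ.sup' Finset.univ_nonempty
      (fun i => dotp (fun j => (a i j : ℝ)) y + c i)

/-- A theta function for (Q, α): convex, regular, quasi-periodic. -/
def IsThetaFn {n : ℕ} (Λ : Set (Fin n → ℝ))
    (Q : (Fin n → ℝ) → (Fin n → ℝ) → ℝ) (α : (Fin n → ℝ) → ℝ)
    (Θ : (Fin n → ℝ) → ℝ) : Prop :=
  ConvexOn ℝ Set.univ Θ ∧ RegularFn Θ ∧ QuasiPeriodic Λ Q α Θ

/-- Q is integral with respect to Λ. -/
def IntegralWrt {n : ℕ} (Q : (Fin n → ℝ) → (Fin n → ℝ) → ℝ) (Λ : Set (Fin n → ℝ)) : Prop :=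
  ∀ l ∈ Λ, ∀ m : Fin n → ℤ, ∃ k : ℤ, Q l (fun i => (m i : ℝ)) = (k : ℝ)

/-- m lies in q(Λ): ⟨m,x⟩ = Q(λ,x) for some λ ∈ Λ and all x. -/
def InQLat {n : ℕ} (Λ : Set (Fin n → ℝ)) (Q : (Fin n → ℝ) → (Fin n → ℝ) → ℝ)
    (m : Fin n → ℝ) : Prop :=
  ∃ l ∈ Λ, ∀ x, dotp m x = Q l x

/-- The generator Θ_b (with v_b passed as `vb`). -/
def ThetaGen {n : ℕ} (Λ : Set (Fin n → ℝ)) (Q : (Fin n → ℝ) → (Fin n → ℝ) → ℝ)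
    (r vb : Fin n → ℝ) (b : Fin n → ℤ) (x : Fin n → ℝ) : ℝ :=
  sSup {t | ∃ l ∈ Λ, t = dotp (fun i => (b i : ℝ)) x + Q l x
      - (1/2) * Q (l + vb - r) (l + vb - r)}

/-- The Legendre transform of Θ. -/
def legendreT {n : ℕ} (Θ : (Fin n → ℝ) → ℝ) (a : Fin n → ℝ) : ℝ :=
  sSup {t | ∃ x, t = dotp a x - Θ x}

/-- The generator Θ_b, with v_b obtained from the duality map v. -/
def thetaGenOf {n : ℕ} (Λ : Set (Fin n → ℝ)) (Q : (Fin n → ℝ) → (Fin n → ℝ) → ℝ)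
    (r : Fin n → ℝ) (v : (Fin n → ℝ) → (Fin n → ℝ)) (b : Fin n → ℤ) :
    (Fin n → ℝ) → ℝ :=
  ThetaGen Λ Q r (v (fun i => (b i : ℝ))) b

/-- φ^b(Θ) = inf_y (Θ(y) − Θ_b(y)). -/
def phiB {n : ℕ} (Λ : Set (Fin n → ℝ)) (Q : (Fin n → ℝ) → (Fin n → ℝ) → ℝ)
    (r : Fin n → ℝ) (v : (Fin n → ℝ) → (Fin n → ℝ)) (b : Fin n → ℤ)
    (Θ : (Fin n → ℝ) → ℝ) : ℝ :=
  sInf {u | ∃ y, u = Θ y - thetaGenOf Λ Q r v b y}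

/-- The coordinate set S ⊂ ℝ^B of tuples (φ^b(Θ))_{b∈B} for theta functions Θ. -/
def thetaCoordSet {n : ℕ} (Λ : Set (Fin n → ℝ)) (Q : (Fin n → ℝ) → (Fin n → ℝ) → ℝ)
    (r : Fin n → ℝ) (v : (Fin n → ℝ) → (Fin n → ℝ)) (B : Finset (Fin n → ℤ)) :
    Set ({b // b ∈ B} → ℝ) :=
  {t | ∃ Θ, IsThetaFn Λ Q (fun x => Q x r) Θ ∧
      ∀ b : {b // b ∈ B}, t b = phiB Λ Q r v b.1 Θ}

/-- Ξ(x) = sup over a ∈ ℤ^n of (⟨a,x⟩ − ½ Q(v_a−r, v_a−r)). -/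
def XiFn {n : ℕ} (Q : (Fin n → ℝ) → (Fin n → ℝ) → ℝ) (v : (Fin n → ℝ) → (Fin n → ℝ))
    (r : Fin n → ℝ) (x : Fin n → ℝ) : ℝ :=
  sSup {t | ∃ a : Fin n → ℤ, t = dotp (fun i => (a i : ℝ)) x
      - (1/2) * Q (v (fun i => (a i : ℝ)) - r) (v (fun i => (a i : ℝ)) - r)}


section Aux

variable {n : ℕ}

/-- The affine functions whose supremum is Θ_b. -/
def auxF (Q : (Fin n → ℝ) → (Fin n → ℝ) → ℝ) (r vb : Fin n → ℝ) (b : Fin n → ℤ)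
    (l x : Fin n → ℝ) : ℝ :=
  dotp (fun i => (b i : ℝ)) x + Q l x - (1/2) * Q (l + vb - r) (l + vb - r)

theorem aux_coercive (B : (Fin n → ℝ) →ₗ[ℝ] (Fin n → ℝ) →ₗ[ℝ] ℝ)
    (hpos : ∀ x, x ≠ 0 → 0 < B x x) :
    Continuous (fun x => B x x) ∧ ∃ c : ℝ, 0 < c ∧ ∀ x, c * ‖x‖ ^ 2 ≤ B x x := by
  have hc : Continuous (fun x => B x x) := by
    have h : ∀ x, B x x = ∑ i, x i * B (Pi.single i 1) x := by
      intro x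
      conv_lhs => rw [LinearMap.pi_apply_eq_sum_univ B x]
      simp only [LinearMap.sum_apply, LinearMap.smul_apply, smul_eq_mul]
      refine Finset.sum_congr rfl fun i _ => ?_
      congr 3
      ext j
      simp [Pi.single_apply, eq_comm]
    simp_rw [h]
    refine continuous_finsetSum _ fun i _ => (continuous_apply i).mul ?_
    exact LinearMap.continuous_of_finiteDimensional _
  refine ⟨hc, ?_⟩
  rcases (Metric.sphere (0 : Fin n → ℝ) 1).eq_empty_or_nonempty with he | hne
  · refine ⟨1, one_pos, fun x => ?_⟩
    by_cases hx : x = 0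
    · simp [hx]
    · exfalso
      have : (‖x‖⁻¹ • x) ∈ Metric.sphere (0 : Fin n → ℝ) 1 := by
        have := norm_ne_zero_iff.2 hx
        simp [norm_smul, this]
      rw [he] at this
      exact this
  · obtain ⟨z, hz, hmin⟩ := (isCompact_sphere (0 : Fin n → ℝ) 1).exists_isMinOn hne hc.continuousOn
    have hz0 : z ≠ 0 := by
      rintro rfl
      simp at hz
    refine ⟨B z z, hpos z hz0, fun x => ?_⟩
    by_cases hx : x = 0
    · simp [hx]
    · have hn := norm_ne_zero_iff.2 hx
      have hm : (‖x‖⁻¹ • x) ∈ Metric.sphere (0 : Fin n → ℝ) 1 := by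
        simp [norm_smul, hn]
      have h1 : B z z ≤ B (‖x‖⁻¹ • x) (‖x‖⁻¹ • x) := hmin hm
      simp only [map_smul, LinearMap.smul_apply, smul_eq_mul] at h1
      have h2 := mul_le_mul_of_nonneg_right h1 (sq_nonneg ‖x‖)
      have h3 : ‖x‖⁻¹ * (‖x‖⁻¹ * B x x) * ‖x‖ ^ 2 = B x x := by field_simp
      linarith

theorem aux_local (Λ : Set (Fin n → ℝ)) (hΛ : IsLattice Λ)
    (B : (Fin n → ℝ) →ₗ[ℝ] (Fin n → ℝ) →ₗ[ℝ] ℝ) (hs : ∀ x y, B x y = B y x)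
    (hpos : ∀ x, x ≠ 0 → 0 < B x x)
    (r vb : Fin n → ℝ) (b : Fin n → ℤ) (hv : ∀ x, B vb x = dotp (fun i => (b i : ℝ)) x)
    (x : Fin n → ℝ) :
    ∃ U ∈ nhds x, ∃ (k : ℕ) (g : Fin (k+1) → Fin n → ℝ), (∀ i, g i ∈ Λ) ∧
      ∀ y ∈ U, ∀ l ∈ Λ, ∃ i, auxF (fun x y => B x y) r vb b l y
        ≤ auxF (fun x y => B x y) r vb b (g i) y := by
  obtain ⟨hc, c, hc0, hcle⟩ := aux_coercive B hpos
  obtain ⟨e, rfl⟩ := hΛ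
  set Λ := {x | ∃ c : Fin n → ℤ, x = ∑ i, (c i : ℝ) • e i} with hΛ
  have h0 : (0 : Fin n → ℝ) ∈ Λ := ⟨0, by simp⟩
  set M := B (vb - r - x) (vb - r - x) + 1 with hM
  have hM0 : 0 < M := by
    have := hcle (vb - r - x)
    have : 0 ≤ c * ‖vb - r - x‖ ^ 2 := by positivity
    linarith
  set U : Set (Fin n → ℝ) := Metric.ball x 1 ∩ {y | B (vb - r - y) (vb - r - y) < M} with hU
  have hUx : U ∈ nhds x := by
    refine Filter.inter_mem (Metric.ball_mem_nhds x one_pos) ?_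
    have h1 : Continuous (fun y => B (vb - r - y) (vb - r - y)) :=
      hc.comp (continuous_const.sub continuous_id)
    exact (isOpen_lt h1 continuous_const).mem_nhds (by simp [hM])
  have hid : ∀ l y, auxF (fun x y => B x y) r vb b l y =
      -(1/2) * B (l + vb - r - y) (l + vb - r - y) + (1/2) * B y y + B r y := by
    intro l y
    simp only [auxF, ← hv, map_sub, map_add, LinearMap.sub_apply, LinearMap.add_apply]
    have a1 := hs y l
    have a2 := hs y vb
    have a3 := hs y r
    linarith
  set F : Set (Fin n → ℝ) := {l | l ∈ Λ ∧ ∃ y ∈ U,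
    auxF (fun x y => B x y) r vb b 0 y ≤ auxF (fun x y => B x y) r vb b l y} with hF
  have hFfin : F.Finite := by
    have hsub : F ⊆ Metric.closedBall (0 : Fin n → ℝ) ((M / c + 1) + ‖vb - r‖ + (‖x‖ + 1)) ∩
        (Submodule.span ℤ (Set.range e) : Set (Fin n → ℝ)) := by
      rintro l ⟨⟨a, ha⟩, y, ⟨hy1, hy2⟩, hle⟩
      refine ⟨?_, ?_⟩
      · rw [hid, hid] at hle
        simp only [zero_add, Set.mem_setOf_eq] at hle hy2
        have h1 := hcle (l + vb - r - y)
        have h2 : ‖l + vb - r - y‖ ^ 2 ≤ M / c := by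
          rw [le_div_iff₀ hc0]; linarith
        have h3 : ‖l + vb - r - y‖ ≤ M / c + 1 := by
          nlinarith [sq_nonneg (‖l + vb - r - y‖ - 1), norm_nonneg (l + vb - r - y)]
        have h4 : ‖y‖ ≤ ‖x‖ + 1 := by
          have : ‖y - x‖ < 1 := by simpa [dist_eq_norm] using hy1
          have h5 := norm_add_le (y - x) x
          rw [sub_add_cancel] at h5
          linarith
        have h6 : l = (l + vb - r - y) - (vb - r) + y := by abel
        have h7 := norm_add_le ((l + vb - r - y) - (vb - r)) y
        rw [← h6] at h7
        have h8 := norm_sub_le (l + vb - r - y) (vb - r)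
        simp only [Metric.mem_closedBall, dist_zero_right]
        linarith
      · rw [ha]
        refine Submodule.sum_mem _ fun i _ => ?_
        rw [Int.cast_smul_eq_zsmul]
        exact Submodule.smul_mem _ _ (Submodule.subset_span ⟨i, rfl⟩)
    exact (ZSpan.setFinite_inter e Metric.isBounded_closedBall).subset hsub
  have h0F : (0 : Fin n → ℝ) ∈ F := ⟨h0, x, mem_of_mem_nhds hUx, le_rfl⟩
  obtain ⟨k, g, -, hg⟩ := hFfin.fin_param
  have hk : k ≠ 0 := by
    rintro rfl
    rw [← hg] at h0F
    obtain ⟨i, -⟩ := h0F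
    exact i.elim0
  obtain ⟨k, rfl⟩ := Nat.exists_eq_succ_of_ne_zero hk
  refine ⟨U, hUx, k, g, fun i => ?_, fun y hy l hl => ?_⟩
  · have : g i ∈ F := hg ▸ Set.mem_range_self i
    exact this.1
  · rcases le_total (auxF (fun x y => B x y) r vb b 0 y) (auxF (fun x y => B x y) r vb b l y)
      with h | h
    · have : l ∈ F := ⟨hl, y, hy, h⟩
      rw [← hg] at this
      obtain ⟨i, rfl⟩ := this
      exact ⟨i, le_rfl⟩
    · rw [← hg] at h0F
      obtain ⟨i, hi⟩ := h0F
      exact ⟨i, hi ▸ h⟩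

end Aux

theorem stmt4 {n : ℕ} (Λ : Set (Fin n → ℝ)) (hΛ : IsLattice Λ)
    (Q : (Fin n → ℝ) → (Fin n → ℝ) → ℝ) (hQ : IsSymmBilin Q)
    (hpos : ∀ x : Fin n → ℝ, x ≠ 0 → 0 < Q x x) (hint : IntegralWrt Q Λ)
    (r : Fin n → ℝ) (v : (Fin n → ℝ) → (Fin n → ℝ))
    (hv : ∀ a x, Q (v a) x = dotp a x) (b : Fin n → ℤ) :
    (∀ x : Fin n → ℝ, ∃ l0 ∈ Λ,
      IsGreatest
        {t | ∃ l ∈ Λ, t = dotp (fun i => (b i : ℝ)) x + Q l x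
          - (1/2) * Q (l + v (fun i => (b i : ℝ)) - r) (l + v (fun i => (b i : ℝ)) - r)}
        (dotp (fun i => (b i : ℝ)) x + Q l0 x
          - (1/2) * Q (l0 + v (fun i => (b i : ℝ)) - r) (l0 + v (fun i => (b i : ℝ)) - r))) ∧
    IsThetaFn Λ Q (fun x => Q x r) (thetaGenOf Λ Q r v b) := by
  obtain ⟨hlin, hs⟩ := hQ
  obtain ⟨B, hB⟩ : ∃ B : (Fin n → ℝ) →ₗ[ℝ] (Fin n → ℝ) →ₗ[ℝ] ℝ, ∀ x y, Q x y = B x y := by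
    refine ⟨LinearMap.mk₂ ℝ Q ?_ ?_ ?_ ?_, fun x y => rfl⟩
    · intro x y z
      rw [hs, (hlin z).map_add, hs z x, hs z y]
    · intro a x z
      rw [hs, (hlin z).map_smul, hs z x]
    · intro x y z
      exact (hlin x).map_add y z
    · intro a x z
      exact (hlin x).map_smul a z
  obtain rfl : Q = fun x y => B x y := by
    funext x y
    exact hB x y
  simp only at *
  set bR : Fin n → ℝ := fun i => (b i : ℝ) with hbR
  have hloc := aux_local Λ hΛ B hs hpos r (v bR) b (hv bR)
  set f := auxF (fun x y => B x y) r (v bR) b with hf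
  have hmax : ∀ x : Fin n → ℝ, ∃ l0 ∈ Λ, IsGreatest {t | ∃ l ∈ Λ, t = f l x} (f l0 x) := by
    intro x
    obtain ⟨U, hU, k, g, hg, h⟩ := hloc x
    obtain ⟨i, hi⟩ := Finite.exists_max (fun i => f (g i) x)
    refine ⟨g i, hg i, ⟨g i, hg i, rfl⟩, ?_⟩
    rintro t ⟨l, hl, rfl⟩
    obtain ⟨j, hj⟩ := h x (mem_of_mem_nhds hU) l hl
    exact hj.trans (hi j)
  have hT : ∀ x, IsGreatest {t | ∃ l ∈ Λ, t = f l x}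
      (thetaGenOf Λ (fun x y => B x y) r v b x) := by
    intro x
    obtain ⟨l0, -, h⟩ := hmax x
    have : thetaGenOf Λ (fun x y => B x y) r v b x = f l0 x := h.csSup_eq
    rw [this]
    exact h
  refine ⟨hmax, ?_, ?_, ?_⟩
  · refine ⟨convex_univ, ?_⟩
    intro x _ y _ s t hs0 ht0 hst
    obtain ⟨l, hl, he⟩ := (hT (s • x + t • y)).1
    have h1 := (hT x).2 ⟨l, hl, rfl⟩
    have h2 := (hT y).2 ⟨l, hl, rfl⟩
    rw [he]
    have h3 : f l (s • x + t • y) = s * f l x + t * f l y := by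
      simp only [hf, auxF, ← hv, map_add, map_smul, smul_eq_mul]
      have : t = 1 - s := by linarith
      subst this
      ring
    rw [h3]
    simp only [smul_eq_mul]
    gcongr
  · intro x
    obtain ⟨U, hU, k, g, hg, h⟩ := hloc x
    choose m hm using fun i j => hint (g i) (hg i) (Pi.single j 1)
    refine ⟨U, hU, k, fun i j => b j + m i j,
      fun i => - (1/2) * B (g i + v bR - r) (g i + v bR - r), fun y hy => ?_⟩
    have hfe : ∀ i, dotp (fun j => ((b j + m i j : ℤ) : ℝ)) y
        + - (1/2) * B (g i + v bR - r) (g i + v bR - r) = f (g i) y := by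
      intro i
      have h5 : B (g i) y = ∑ j, (m i j : ℝ) * y j := by
        rw [LinearMap.pi_apply_eq_sum_univ (B (g i)) y]
        refine Finset.sum_congr rfl fun j _ => ?_
        rw [← hm, smul_eq_mul, mul_comm]
        congr 2
        ext q
        by_cases hq : j = q
        · subst hq; simp
        · simp [hq, Pi.single_apply, Ne.symm hq, eq_comm]
      simp only [hf, auxF, h5, dotp]
      push_cast
      simp only [add_mul, Finset.sum_add_distrib]
      ring
    simp only [hfe]
    apply le_antisymm
    · obtain ⟨l, hl, he⟩ := (hT y).1
      obtain ⟨i, hi⟩ := h y hy l hl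
      rw [he]
      exact hi.trans (Finset.le_sup' (fun i => f (g i) y) (Finset.mem_univ i))
    · exact Finset.sup'_le _ _ fun i _ => (hT y).2 ⟨g i, hg i, rfl⟩
  · have key : ∀ l m x, f l (x + m) = f (l - m) x + B m x + (1/2) * B m m + B m r := by
      intro l m x
      simp only [hf, auxF]
      rw [← hbR, ← hv, ← hv]
      simp only [map_sub, map_add, LinearMap.sub_apply, LinearMap.add_apply]
      have a1 := hs m l
      have a2 := hs m (v bR)
      have a3 := hs m r
      linarith
    have hadd : ∀ l ∈ Λ, ∀ m ∈ Λ, l + m ∈ Λ ∧ l - m ∈ Λ := by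
      obtain ⟨e, rfl⟩ := hΛ
      rintro _ ⟨c, rfl⟩ _ ⟨d, rfl⟩
      exact ⟨⟨c + d, by simp [add_smul, Finset.sum_add_distrib]⟩,
        ⟨c - d, by simp [sub_smul, Finset.sum_sub_distrib]⟩⟩
    intro m hm x
    apply le_antisymm
    · obtain ⟨l, hl, he⟩ := (hT (x + m)).1
      rw [he, key]
      have := (hT x).2 ⟨l - m, (hadd l hl m hm).2, rfl⟩
      linarith
    · obtain ⟨l, hl, he⟩ := (hT x).1
      have h1 := (hT (x + m)).2 ⟨l + m, (hadd l hl m hm).1, rfl⟩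
      rw [key, add_sub_cancel_right] at h1
      rw [he]
      linarith
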